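/- The functional J_Ψ is strictly convex on the convex open set L^H_Γ: for all Λ₀ ≠ Λ₁ in L^H_Γ and 0 < t < 1, J_Ψ((1−t)Λ₀ + tΛ₁) < (1−t)J_Ψ(Λ₀) + t J_Ψ(Λ₁). -/

import Mathlib

open Matrix MeasureTheory
open scoped ComplexOrder

/-- Entrywise integral over the unit circle, `∫_{-π}^{π} F(e^{jθ}) dθ/2π`. -/
noncomputable def circleIntM {n m : ℕ} (F : ℝ → Matrix (Fin n) (Fin m) ℂ) :
    Matrix (Fin n) (Fin m) ℂ :=
  Matrix.of fun i j => (2 * (Real.pi : ℂ))⁻¹ * ∫ θ in (-Real.pi)..Real.pi, F θ i j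

/-- The transfer function `G(z) = (zI - A)⁻¹ B` evaluated at `z = e^{jθ}`. -/
noncomputable def Gfun {n m : ℕ} (A : Matrix (Fin n) (Fin n) ℂ)
    (B : Matrix (Fin n) (Fin m) ℂ) (θ : ℝ) : Matrix (Fin n) (Fin m) ℂ :=
  (Complex.exp (θ * Complex.I) • (1 : Matrix (Fin n) (Fin n) ℂ) - A)⁻¹ * B

/-- The pair `(A, B)` is reachable: the controllability matrix
`[B, AB, ..., A^{n-1}B]` has rank `n`. -/
noncomputable def IsReachable {n m : ℕ} (A : Matrix (Fin n) (Fin n) ℂ)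
    (B : Matrix (Fin n) (Fin m) ℂ) : Prop :=
  (Matrix.of fun (i : Fin n) (p : Fin n × Fin m) => (A ^ (p.1 : ℕ) * B) i p.2).rank = n

/-- `Q_Λ(e^{jθ}) = I + G(e^{jθ})* Λ G(e^{jθ})`. -/
noncomputable def Qfun {n m : ℕ} (A : Matrix (Fin n) (Fin n) ℂ)
    (B : Matrix (Fin n) (Fin m) ℂ) (Λ : Matrix (Fin n) (Fin n) ℂ) (θ : ℝ) :
    Matrix (Fin m) (Fin m) ℂ :=
  (1 : Matrix (Fin m) (Fin m) ℂ) + (Gfun A B θ)ᴴ * Λ * Gfun A B θ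

/-- The dual functional `J_Ψ(Λ) = tr ∫ Q_Λ⁻¹ Ψ + tr Λ` (a real number). -/
noncomputable def Jfun {n m : ℕ} (A : Matrix (Fin n) (Fin n) ℂ)
    (B : Matrix (Fin n) (Fin m) ℂ) (Ψ : ℝ → Matrix (Fin m) (Fin m) ℂ)
    (Λ : Matrix (Fin n) (Fin n) ℂ) : ℝ :=
  ((circleIntM fun θ => (Qfun A B Λ θ)⁻¹ * Ψ θ).trace + Λ.trace).re

/-- `M` belongs to `Range Γ`: it is `∫ G Φ G*` for some continuous Hermitian-matrix-valued
function `Φ` on the unit circle. -/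
def InRangeGamma {n m : ℕ} (A : Matrix (Fin n) (Fin n) ℂ) (B : Matrix (Fin n) (Fin m) ℂ)
    (M : Matrix (Fin n) (Fin n) ℂ) : Prop :=
  ∃ Φ : ℝ → Matrix (Fin m) (Fin m) ℂ,
    Continuous Φ ∧ Function.Periodic Φ (2 * Real.pi) ∧
    (∀ θ : ℝ, (Φ θ).IsHermitian) ∧
    circleIntM (fun θ => Gfun A B θ * Φ θ * (Gfun A B θ)ᴴ) = M

/-- A matrix-valued function that is continuous and everywhere invertible has a continuous
inverse. -/
theorem Continuous.matrix_inv_of_isUnit {X : Type*} [TopologicalSpace X] {k : ℕ}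
    {F : X → Matrix (Fin k) (Fin k) ℂ} (hF : Continuous F) (hu : ∀ x, IsUnit (F x)) :
    Continuous fun x => (F x)⁻¹ := by
  simp only [Matrix.inv_def, Ring.inverse_eq_inv']
  refine Continuous.smul (hF.matrix_det.inv₀ fun x => ?_) hF.matrix_adjugate
  exact ((Matrix.isUnit_iff_isUnit_det _).1 (hu x)).ne_zero

open scoped MatrixOrder in
theorem Matrix.PosDef.exists_isUnit_eq_conjTranspose_mul_self {k : ℕ}
    {P : Matrix (Fin k) (Fin k) ℂ} (hP : P.PosDef) : ∃ R, IsUnit R ∧ P = Rᴴ * R := by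
  obtain ⟨R, hR⟩ := CStarAlgebra.nonneg_iff_eq_star_mul_self.mp hP.posSemidef.nonneg
  refine ⟨R, ?_, hR⟩
  have h := hP.isUnit
  rw [hR, Matrix.isUnit_iff_isUnit_det, Matrix.det_mul] at h
  exact (Matrix.isUnit_iff_isUnit_det _).2 (isUnit_of_mul_isUnit_right h)

theorem Matrix.PosDef.re_trace_conjTranspose_mul_mul_mul_pos {k : ℕ}
    {S Y M : Matrix (Fin k) (Fin k) ℂ} (hS : S.PosDef) (hY : Y.PosDef) (hM : M ≠ 0) :
    0 < (Mᴴ * S * M * Y).trace.re := by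
  obtain ⟨T, hT, rfl⟩ := hS.exists_isUnit_eq_conjTranspose_mul_self
  obtain ⟨R, hR, rfl⟩ := hY.exists_isUnit_eq_conjTranspose_mul_self
  have e : (Mᴴ * (Tᴴ * T) * M * (Rᴴ * R)).trace
      = ((T * M * Rᴴ)ᴴ * (T * M * Rᴴ)).trace := by
    rw [← Matrix.mul_assoc _ Rᴴ R, Matrix.trace_mul_comm]
    simp only [Matrix.conjTranspose_mul, Matrix.conjTranspose_conjTranspose, Matrix.mul_assoc]
  have hne : (T * M * Rᴴ) ≠ 0 := by
    have hR' : IsUnit Rᴴ := hR.star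
    rwa [Ne, hR'.mul_left_eq_zero, hT.mul_right_eq_zero]
  have hpos : 0 < ((T * M * Rᴴ)ᴴ * (T * M * Rᴴ)).trace :=
    lt_of_le_of_ne (Matrix.posSemidef_conjTranspose_mul_self _).trace_nonneg
      fun h => hne (Matrix.trace_conjTranspose_mul_self_eq_zero_iff.1 h.symm)
  rw [e]
  exact (Complex.lt_def.1 hpos).1

/-- `P ↦ tr (P⁻¹ Y)` lies strictly above its tangent at `R`. -/
theorem Matrix.PosDef.re_trace_inv_mul_tangent_lt {k : ℕ}
    {P R Y : Matrix (Fin k) (Fin k) ℂ} (hP : P.PosDef) (hR : R.PosDef) (hY : Y.PosDef)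
    (hne : P ≠ R) :
    (R⁻¹ * Y).trace.re - (R⁻¹ * (P - R) * R⁻¹ * Y).trace.re < (P⁻¹ * Y).trace.re := by
  have hPd := (Matrix.isUnit_iff_isUnit_det _).1 hP.isUnit
  have hRd := (Matrix.isUnit_iff_isUnit_det _).1 hR.isUnit
  have hM : P * R⁻¹ - 1 ≠ 0 := fun h => hne <| by
    have h' := congrArg (· * R) (sub_eq_zero.1 h)
    simpa [Matrix.mul_assoc, Matrix.nonsing_inv_mul _ hRd] using h'
  have hpos := hP.inv.re_trace_conjTranspose_mul_mul_mul_pos hY hM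
  have e : (P * R⁻¹ - 1)ᴴ * P⁻¹ * (P * R⁻¹ - 1)
      = P⁻¹ - R⁻¹ + R⁻¹ * (P - R) * R⁻¹ := by
    rw [Matrix.conjTranspose_sub, Matrix.conjTranspose_mul, hP.isHermitian.eq,
      hR.inv.isHermitian.eq, Matrix.conjTranspose_one]
    simp only [Matrix.sub_mul, Matrix.mul_sub, Matrix.one_mul, Matrix.mul_one, Matrix.mul_assoc,
      Matrix.mul_nonsing_inv _ hPd, Matrix.mul_nonsing_inv _ hRd,
      Matrix.nonsing_inv_mul_cancel_left _ _ hPd]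
    abel
  rw [e] at hpos
  simp only [Matrix.add_mul, Matrix.sub_mul, Matrix.trace_add, Matrix.trace_sub, Complex.add_re,
    Complex.sub_re] at hpos ⊢
  linarith

theorem Matrix.PosDef.convexCombo {k : ℕ} {P Q : Matrix (Fin k) (Fin k) ℂ} (hP : P.PosDef)
    (hQ : Q.PosDef) {t : ℝ} (ht0 : 0 < t) (ht1 : t < 1) : ((1 - t) • P + t • Q).PosDef :=
  (hP.smul (sub_pos.2 ht1)).add (hQ.smul ht0)

/-- `P ↦ tr (P⁻¹ Y)` is strictly convex on positive definite matrices. -/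
theorem Matrix.PosDef.re_trace_inv_mul_convexCombo_lt {k : ℕ}
    {P Q Y : Matrix (Fin k) (Fin k) ℂ} (hP : P.PosDef) (hQ : Q.PosDef) (hY : Y.PosDef)
    (hne : P ≠ Q) {t : ℝ} (ht0 : 0 < t) (ht1 : t < 1) :
    (((1 - t) • P + t • Q)⁻¹ * Y).trace.re
      < (1 - t) * (P⁻¹ * Y).trace.re + t * (Q⁻¹ * Y).trace.re := by
  have hR := hP.convexCombo hQ ht0 ht1
  set R := (1 - t) • P + t • Q with hRdef
  have eP : P - R = (-t) • (Q - P) := by rw [hRdef]; module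
  have eQ : Q - R = (1 - t) • (Q - P) := by rw [hRdef]; module
  have hD : Q - P ≠ 0 := sub_ne_zero.2 hne.symm
  have nP : P ≠ R := sub_ne_zero.1 (eP ▸ smul_ne_zero (neg_ne_zero.2 ht0.ne') hD)
  have nQ : Q ≠ R := sub_ne_zero.1 (eQ ▸ smul_ne_zero (sub_pos.2 ht1).ne' hD)
  have h1 := hP.re_trace_inv_mul_tangent_lt hR hY nP
  have h2 := hQ.re_trace_inv_mul_tangent_lt hR hY nQ
  rw [eP] at h1
  rw [eQ] at h2
  simp only [Matrix.mul_smul, Matrix.smul_mul, Matrix.trace_smul, Complex.smul_re,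
    smul_eq_mul] at h1 h2
  nlinarith [mul_lt_mul_of_pos_left h1 (sub_pos.2 ht1), mul_lt_mul_of_pos_left h2 ht0]

theorem trace_circleIntM_mul {n : ℕ} {F : ℝ → Matrix (Fin n) (Fin n) ℂ} (hF : Continuous F)
    (N : Matrix (Fin n) (Fin n) ℂ) :
    (circleIntM F * N).trace
      = (2 * (Real.pi : ℂ))⁻¹ * ∫ θ in (-Real.pi)..Real.pi, (F θ * N).trace := by
  have hc : ∀ i j, Continuous fun θ => F θ i j * N j i := fun i j =>
    (hF.matrix_elem i j).mul continuous_const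
  simp only [Matrix.trace, Matrix.diag, Matrix.mul_apply, circleIntM, Matrix.of_apply]
  rw [intervalIntegral.integral_finsetSum fun i _ =>
    (continuous_finsetSum _ fun j _ => hc i j).intervalIntegrable _ _, Finset.mul_sum]
  refine Finset.sum_congr rfl fun i _ => ?_
  rw [intervalIntegral.integral_finsetSum fun j _ => (hc i j).intervalIntegrable _ _,
    Finset.mul_sum]
  refine Finset.sum_congr rfl fun j _ => ?_
  rw [intervalIntegral.integral_mul_const, mul_assoc]

theorem re_trace_circleIntM {n : ℕ} {F : ℝ → Matrix (Fin n) (Fin n) ℂ} (hF : Continuous F) :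
    (circleIntM F).trace.re
      = (2 * Real.pi)⁻¹ * ∫ θ in (-Real.pi)..Real.pi, (F θ).trace.re := by
  have h := trace_circleIntM_mul hF 1
  simp only [Matrix.mul_one] at h
  have hre := Complex.reCLM.intervalIntegral_comp_comm
    (hF.matrix_trace.intervalIntegrable (μ := volume) (-Real.pi) Real.pi)
  simp only [Complex.reCLM_apply] at hre
  have hc : (2 * (Real.pi : ℂ))⁻¹ = (((2 * Real.pi)⁻¹ : ℝ) : ℂ) := by push_cast; rfl
  rw [h, hc, Complex.re_ofReal_mul, hre]

theorem continuous_Gfun {n m : ℕ} {A : Matrix (Fin n) (Fin n) ℂ} (B : Matrix (Fin n) (Fin m) ℂ)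
    (hA : ∀ z ∈ spectrum ℂ A, ‖z‖ < 1) : Continuous (Gfun A B) := by
  unfold Gfun
  refine Continuous.matrix_mul (Continuous.matrix_inv_of_isUnit ?_ fun θ => ?_) continuous_const
  · fun_prop
  · have h : Complex.exp (θ * Complex.I) ∉ spectrum ℂ A := fun h =>
      (hA _ h).ne (Complex.norm_exp_ofReal_mul_I θ)
    rw [spectrum.notMem_iff, Algebra.algebraMap_eq_smul_one] at h
    exact h

theorem continuous_Qfun {n m : ℕ} {A : Matrix (Fin n) (Fin n) ℂ} (B : Matrix (Fin n) (Fin m) ℂ)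
    (hA : ∀ z ∈ spectrum ℂ A, ‖z‖ < 1) (Λ : Matrix (Fin n) (Fin n) ℂ) :
    Continuous (Qfun A B Λ) := by
  have hG := continuous_Gfun B hA
  exact continuous_const.add ((hG.matrix_conjTranspose.matrix_mul continuous_const).matrix_mul hG)

theorem Qfun_convexCombo {n m : ℕ} (A : Matrix (Fin n) (Fin n) ℂ) (B : Matrix (Fin n) (Fin m) ℂ)
    (Λ₀ Λ₁ : Matrix (Fin n) (Fin n) ℂ) (t θ : ℝ) :
    Qfun A B ((1 - t) • Λ₀ + t • Λ₁) θ = (1 - t) • Qfun A B Λ₀ θ + t • Qfun A B Λ₁ θ := by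
  simp only [Qfun, Matrix.mul_add, Matrix.add_mul, Matrix.mul_smul, Matrix.smul_mul]
  module

/-- The range of `Γ` is orthogonal to every `N` with `G* N G = 0` on the circle. -/
theorem InRangeGamma.trace_mul_eq_zero {n m : ℕ} {A : Matrix (Fin n) (Fin n) ℂ}
    {B : Matrix (Fin n) (Fin m) ℂ} (hA : ∀ z ∈ spectrum ℂ A, ‖z‖ < 1)
    {M N : Matrix (Fin n) (Fin n) ℂ} (hM : InRangeGamma A B M)
    (hN : ∀ θ ∈ Set.Icc (-Real.pi) Real.pi, (Gfun A B θ)ᴴ * N * Gfun A B θ = 0) :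
    (M * N).trace = 0 := by
  obtain ⟨Φ, hΦ, -, -, rfl⟩ := hM
  have hG := continuous_Gfun B hA
  rw [trace_circleIntM_mul ((hG.matrix_mul hΦ).matrix_mul hG.matrix_conjTranspose)]
  have hint : ∫ θ in (-Real.pi)..Real.pi,
      (Gfun A B θ * Φ θ * (Gfun A B θ)ᴴ * N).trace = ∫ θ in (-Real.pi)..Real.pi, (0 : ℂ) := by
    refine intervalIntegral.integral_congr fun θ hθ => ?_
    rw [Set.uIcc_of_le (by linarith [Real.pi_pos])] at hθ
    have h := hN θ hθ
    rw [Matrix.mul_assoc] at h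
    simp only [Matrix.mul_assoc]
    rw [Matrix.trace_mul_comm]
    simp only [Matrix.mul_assoc, h, Matrix.mul_zero, Matrix.trace_zero]
  rw [hint]
  simp

/-- Elements of the range of `Γ` are determined by `Q_Λ` on the circle. -/
theorem InRangeGamma.eq_of_Qfun_eq {n m : ℕ} {A : Matrix (Fin n) (Fin n) ℂ}
    {B : Matrix (Fin n) (Fin m) ℂ} (hA : ∀ z ∈ spectrum ℂ A, ‖z‖ < 1)
    {M N : Matrix (Fin n) (Fin n) ℂ} (hM : InRangeGamma A B M) (hN : InRangeGamma A B N)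
    (h : ∀ θ ∈ Set.Icc (-Real.pi) Real.pi, Qfun A B M θ = Qfun A B N θ) : M = N := by
  have hD : ∀ θ ∈ Set.Icc (-Real.pi) Real.pi,
      (Gfun A B θ)ᴴ * (M - N)ᴴ * Gfun A B θ = 0 := fun θ hθ => by
    have e : (Gfun A B θ)ᴴ * (M - N) * Gfun A B θ = 0 := by
      rw [Matrix.mul_sub, Matrix.sub_mul, sub_eq_zero]
      exact add_left_cancel (h θ hθ)
    simpa [Matrix.mul_assoc] using congrArg Matrix.conjTranspose e
  refine sub_eq_zero.1 (Matrix.trace_mul_conjTranspose_self_eq_zero_iff.1 ?_)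
  rw [Matrix.sub_mul, Matrix.trace_sub, hM.trace_mul_eq_zero hA hD, hN.trace_mul_eq_zero hA hD,
    sub_zero]

theorem stmt11 {n m : ℕ} (A : Matrix (Fin n) (Fin n) ℂ) (B : Matrix (Fin n) (Fin m) ℂ)
    (hA : ∀ z ∈ spectrum ℂ A, ‖z‖ < 1) (hB : B.rank = m) (hAB : IsReachable A B)
    (Ψ : ℝ → Matrix (Fin m) (Fin m) ℂ) (hΨc : Continuous Ψ)
    (hΨper : Function.Periodic Ψ (2 * Real.pi)) (hΨpd : ∀ θ : ℝ, (Ψ θ).PosDef)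
    (Λ₀ Λ₁ : Matrix (Fin n) (Fin n) ℂ)
    (hΛ₀ : InRangeGamma A B Λ₀ ∧ ∀ θ : ℝ, (Qfun A B Λ₀ θ).PosDef)
    (hΛ₁ : InRangeGamma A B Λ₁ ∧ ∀ θ : ℝ, (Qfun A B Λ₁ θ).PosDef)
    (hne : Λ₀ ≠ Λ₁) (t : ℝ) (ht0 : 0 < t) (ht1 : t < 1) :
    Jfun A B Ψ ((1 - t) • Λ₀ + t • Λ₁) <
      (1 - t) * Jfun A B Ψ Λ₀ + t * Jfun A B Ψ Λ₁ := by
  have hπ : -Real.pi < Real.pi := by linarith [Real.pi_pos]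
  obtain ⟨θ₀, hθ₀, hQne⟩ :
      ∃ θ ∈ Set.Icc (-Real.pi) Real.pi, Qfun A B Λ₀ θ ≠ Qfun A B Λ₁ θ := by
    by_contra! h
    exact hne (hΛ₀.1.eq_of_Qfun_eq hA hΛ₁.1 h)
  have hcont : ∀ Λ, (∀ θ, (Qfun A B Λ θ).PosDef) → Continuous fun θ => (Qfun A B Λ θ)⁻¹ * Ψ θ :=
    fun Λ h => ((continuous_Qfun B hA Λ).matrix_inv_of_isUnit fun θ => (h θ).isUnit).matrix_mul hΨc
  have hpd : ∀ θ, (Qfun A B ((1 - t) • Λ₀ + t • Λ₁) θ).PosDef := fun θ => by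
    rw [Qfun_convexCombo]
    exact (hΛ₀.2 θ).convexCombo (hΛ₁.2 θ) ht0 ht1
  have hre : ∀ Λ, (∀ θ, (Qfun A B Λ θ).PosDef) →
      Continuous fun θ => ((Qfun A B Λ θ)⁻¹ * Ψ θ).trace.re :=
    fun Λ h => Complex.continuous_re.comp (hcont Λ h).matrix_trace
  have c₀ : Continuous fun θ => (1 - t) * ((Qfun A B Λ₀ θ)⁻¹ * Ψ θ).trace.re :=
    continuous_const.mul (hre _ hΛ₀.2)
  have c₁ : Continuous fun θ => t * ((Qfun A B Λ₁ θ)⁻¹ * Ψ θ).trace.re :=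
    continuous_const.mul (hre _ hΛ₁.2)
  have key : ∫ θ in (-Real.pi)..Real.pi,
        ((Qfun A B ((1 - t) • Λ₀ + t • Λ₁) θ)⁻¹ * Ψ θ).trace.re
      < ∫ θ in (-Real.pi)..Real.pi, ((1 - t) * ((Qfun A B Λ₀ θ)⁻¹ * Ψ θ).trace.re
          + t * ((Qfun A B Λ₁ θ)⁻¹ * Ψ θ).trace.re) := by
    refine intervalIntegral.integral_lt_integral_of_continuousOn_of_le_of_exists_lt hπ
      (hre _ hpd).continuousOn (c₀.add c₁).continuousOn
      (fun θ _ => ?_) ⟨θ₀, hθ₀, ?_⟩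
    · rw [Qfun_convexCombo]
      by_cases h : Qfun A B Λ₀ θ = Qfun A B Λ₁ θ
      · rw [h, ← add_smul, ← add_mul, sub_add_cancel, one_smul, one_mul]
      · exact ((hΛ₀.2 θ).re_trace_inv_mul_convexCombo_lt (hΛ₁.2 θ) (hΨpd θ) h ht0 ht1).le
    · rw [Qfun_convexCombo]
      exact (hΛ₀.2 θ₀).re_trace_inv_mul_convexCombo_lt (hΛ₁.2 θ₀) (hΨpd θ₀) hQne ht0 ht1
  rw [intervalIntegral.integral_add (c₀.intervalIntegrable _ _) (c₁.intervalIntegrable _ _),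
    intervalIntegral.integral_const_mul, intervalIntegral.integral_const_mul] at key
  have key' := mul_lt_mul_of_pos_left key (inv_pos.2 Real.two_pi_pos)
  simp only [Jfun, Complex.add_re, re_trace_circleIntM (hcont _ hΛ₀.2),
    re_trace_circleIntM (hcont _ hΛ₁.2), re_trace_circleIntM (hcont _ hpd), Matrix.trace_add,
    Matrix.trace_smul, Complex.smul_re, smul_eq_mul]
  linarith
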